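/- arXiv:1803.04865 — 9 statements merged into one kernel-verified Lean document; each statement's English description precedes it below -/
import Mathlib

section
/- Facility domination (Proposition 1). Let i1, i2 ∈ F be facilities such that C_{i2}^r ⊆ C_{i1}^r and Q(i1) ≥ K_{i2}(r). Then for every feasible CSCP-r solution (x, Y) there exists a feasible CSCP-r solution (x', Y') with |Y'| ≤ |Y| such that i2 ∈ Y' implies i1 ∈ Y'. -/
open Finset

/-- The coverage set `C_i^r` of facility `i` for radius `r`. -/
noncomputable def coverSet {F C : Type*} [Fintype C]
    (d : F → C → ℝ) (q : C → ℕ) (Q : F → ℕ) (r : ℝ) (i : F) : Finset C :=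
  Finset.univ.filter (fun j => d i j ≤ r ∧ q j ≤ Q i)

/-- Demand `Δ_i(r)` located inside the coverage area of facility `i`. -/
noncomputable def coverDemand {F C : Type*} [Fintype C]
    (d : F → C → ℝ) (q : C → ℕ) (Q : F → ℕ) (r : ℝ) (i : F) : ℕ :=
  ∑ j ∈ coverSet d q Q r i, q j

/-- `K_i(r) = min(Δ_i(r), Q_i)`. -/
noncomputable def coverCap {F C : Type*} [Fintype C]
    (d : F → C → ℝ) (q : C → ℕ) (Q : F → ℕ) (r : ℝ) (i : F) : ℕ :=
  min (coverDemand d q Q r i) (Q i)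

/-- Feasibility of a CSCP-r solution `(x, Y)`. -/
def CSCPFeasible {F C : Type*} [Fintype C] [DecidableEq F] [DecidableEq C]
    (d : F → C → ℝ) (q : C → ℕ) (Q : F → ℕ) (r : ℝ)
    (x : Finset (F × C)) (Y : Finset F) : Prop :=
  (∀ j : C, ∃ i : F, (i, j) ∈ x) ∧
  (∀ i : F, ∀ j : C, (i, j) ∈ x → j ∈ coverSet d q Q r i ∧ i ∈ Y) ∧
  (∀ i : F, ∑ j ∈ Finset.univ.filter (fun j => (i, j) ∈ x), q j ≤ Q i)

/-- The demand served by a facility in a feasible solution is at most its effective capacity. -/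
theorem CSCPFeasible.sum_le_coverCap {F C : Type*} [Fintype C] [DecidableEq F] [DecidableEq C]
    {d : F → C → ℝ} {q : C → ℕ} {Q : F → ℕ} {r : ℝ} {x : Finset (F × C)} {Y : Finset F}
    (h : CSCPFeasible d q Q r x Y) (i : F) :
    ∑ j ∈ Finset.univ.filter (fun j => (i, j) ∈ x), q j ≤ coverCap d q Q r i := by
  refine le_min (Finset.sum_le_sum_of_subset fun j hj => ?_) (h.2.2 i)
  exact (h.2.1 i j (Finset.mem_filter.1 hj).2).1

/-- **Facility domination (Proposition 1).** -/
theorem facility_domination {F C : Type*} [Fintype F] [Fintype C]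
    [DecidableEq F] [DecidableEq C]
    (d : F → C → ℝ) (q : C → ℕ) (Q : F → ℕ) (r : ℝ) (i₁ i₂ : F)
    (hsub : coverSet d q Q r i₂ ⊆ coverSet d q Q r i₁)
    (hcap : coverCap d q Q r i₂ ≤ Q i₁)
    (x : Finset (F × C)) (Y : Finset F)
    (hfeas : CSCPFeasible d q Q r x Y) :
    ∃ (x' : Finset (F × C)) (Y' : Finset F),
      CSCPFeasible d q Q r x' Y' ∧ Y'.card ≤ Y.card ∧ (i₂ ∈ Y' → i₁ ∈ Y') := by
  by_cases hY : i₂ ∈ Y → i₁ ∈ Y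
  · exact ⟨x, Y, hfeas, le_rfl, hY⟩
  obtain ⟨h₂, h₁⟩ := Classical.not_imp.1 hY
  have hne : i₁ ≠ i₂ := fun h => h₁ (h ▸ h₂)
  have hx₁ (j : C) : (i₁, j) ∉ x := fun h => h₁ (hfeas.2.1 i₁ j h).2
  -- Swapping the two facilities moves every customer of `i₂` to `i₁`.
  refine ⟨Finset.univ.filter fun p => (Equiv.swap i₁ i₂ p.1, p.2) ∈ x,
    insert i₁ (Y.erase i₂), ⟨fun j => ?_, fun i j hij => ?_, fun i => ?_⟩, ?_, by simp⟩
  · obtain ⟨i, hi⟩ := hfeas.1 j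
    exact ⟨Equiv.swap i₁ i₂ i, by simpa using hi⟩
  · simp only [Finset.mem_filter, Finset.mem_univ, true_and] at hij
    rcases eq_or_ne i i₁ with rfl | hi₁
    · rw [Equiv.swap_apply_left] at hij
      exact ⟨hsub (hfeas.2.1 _ _ hij).1, Finset.mem_insert_self _ _⟩
    rcases eq_or_ne i i₂ with rfl | hi₂
    · rw [Equiv.swap_apply_right] at hij
      exact absurd hij (hx₁ j)
    rw [Equiv.swap_apply_of_ne_of_ne hi₁ hi₂] at hij
    obtain ⟨hc, hi⟩ := hfeas.2.1 _ _ hij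
    exact ⟨hc, by simp [hi, hi₂]⟩
  · simp only [Finset.mem_filter, Finset.mem_univ, true_and]
    rcases eq_or_ne i i₁ with rfl | hi₁
    · rw [Equiv.swap_apply_left]
      exact (hfeas.sum_le_coverCap i₂).trans hcap
    rcases eq_or_ne i i₂ with rfl | hi₂
    · simp [hx₁]
    rw [Equiv.swap_apply_of_ne_of_ne hi₁ hi₂]
    exact hfeas.2.2 i
  · rw [← Finset.card_erase_add_one h₂]
    exact Finset.card_insert_le _ _
end

section
/- Forcing service (Proposition 2). Let i ∈ F be a facility with Δ_i(r) ≤ Q(i). Then for every feasible CSCP-r solution (x, Y) there exists a feasible CSCP-r solution (x', Y) with the same open set Y (hence the same objective value), with x ⊆ x', and such that if i ∈ Y then (i,j) ∈ x' for every j ∈ C_i^r. -/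
open Finset

/-- **Forcing service (Proposition 2).** If `Δ_i(r) ≤ Q i`, any feasible solution can be
extended (same open set) so that an open `i` serves every customer in its coverage set. -/
theorem forcing_service {F C : Type*} [Fintype F] [Fintype C]
    [DecidableEq F] [DecidableEq C]
    (d : F → C → ℝ) (q : C → ℕ) (Q : F → ℕ) (r : ℝ) (i : F)
    (hcap : ∑ j ∈ coverSet d q Q r i, q j ≤ Q i)
    (x : Finset (F × C)) (Y : Finset F)
    (hfeas : CSCPFeasible d q Q r x Y) :
    ∃ x' : Finset (F × C),
      CSCPFeasible d q Q r x' Y ∧ x ⊆ x' ∧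
      (i ∈ Y → ∀ j ∈ coverSet d q Q r i, (i, j) ∈ x') := by
  obtain ⟨hserve, hopen, hload⟩ := hfeas
  by_cases hi : i ∈ Y
  swap
  · exact ⟨x, ⟨hserve, hopen, hload⟩, Subset.rfl, fun h => absurd h hi⟩
  have hmem (k : F) (j : C) : (k, j) ∈ x ∪ {i} ×ˢ coverSet d q Q r i ↔
      (k, j) ∈ x ∨ k = i ∧ j ∈ coverSet d q Q r i := by
    simp only [mem_union, mem_product, mem_singleton]
  refine ⟨x ∪ {i} ×ˢ coverSet d q Q r i, ⟨fun j => ?_, fun k j hkj => ?_, fun k => ?_⟩,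
    subset_union_left, fun _ j hj => (hmem i j).2 (Or.inr ⟨rfl, hj⟩)⟩
  · obtain ⟨k, hk⟩ := hserve j
    exact ⟨k, (hmem k j).2 (Or.inl hk)⟩
  · rcases (hmem k j).1 hkj with h | ⟨rfl, hj⟩
    · exact hopen k j h
    · exact ⟨hj, hi⟩
  · by_cases hk : k = i
    · subst hk
      refine (sum_le_sum_of_subset fun j hj => ?_).trans hcap
      rcases (hmem k j).1 (mem_filter.1 hj).2 with h | ⟨-, h⟩
      · exact (hopen k j h).1
      · exact h
    · simpa only [hmem, hk, false_and, or_false] using hload k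
end

section
/- Symmetry breaking (Proposition 4). Let i1, i2 ∈ F be distinct facilities and j1, j2 ∈ C be distinct customers with q(j1) = q(j2) and with both j1 and j2 belonging to C_{i1}^r ∩ C_{i2}^r. Then for every feasible CSCP-r solution (x, Y) there exists a feasible CSCP-r solution (x', Y) with the same open set Y (hence the same objective value) such that not both (i1, j2) ∈ x' and (i2, j1) ∈ x'. -/
open Finset

/-- Replacing a member of a finset by an element of equal weight does not increase the total
weight. -/
theorem sum_le_of_subset_insert_erase {C : Type*} [DecidableEq C] (q : C → ℕ)
    {S T : Finset C} {a b : C} (hb : b ∈ S) (hq : q a = q b) (hT : T ⊆ insert a (S.erase b)) :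
    ∑ j ∈ T, q j ≤ ∑ j ∈ S, q j :=
  calc ∑ j ∈ T, q j ≤ ∑ j ∈ insert a (S.erase b), q j := Finset.sum_le_sum_of_subset hT
    _ ≤ q a + ∑ j ∈ S.erase b, q j := by
      by_cases ha : a ∈ S.erase b
      · rw [Finset.insert_eq_of_mem ha]
        exact Nat.le_add_left _ _
      · rw [Finset.sum_insert ha]
    _ = ∑ j ∈ S, q j := by rw [hq, Finset.add_sum_erase S q hb]

/-- **Symmetry breaking (Proposition 4).** -/
theorem symmetry_breaking {F C : Type*} [Fintype F] [Fintype C]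
    [DecidableEq F] [DecidableEq C]
    (d : F → C → ℝ) (q : C → ℕ) (Q : F → ℕ) (r : ℝ)
    (i₁ i₂ : F) (j₁ j₂ : C)
    (hi : i₁ ≠ i₂) (hj : j₁ ≠ j₂) (hq : q j₁ = q j₂)
    (hj₁ : j₁ ∈ coverSet d q Q r i₁ ∩ coverSet d q Q r i₂)
    (hj₂ : j₂ ∈ coverSet d q Q r i₁ ∩ coverSet d q Q r i₂)
    (x : Finset (F × C)) (Y : Finset F)
    (hfeas : CSCPFeasible d q Q r x Y) :
    ∃ x' : Finset (F × C),
      CSCPFeasible d q Q r x' Y ∧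
      ¬((i₁, j₂) ∈ x' ∧ (i₂, j₁) ∈ x') := by
  by_cases h : (i₁, j₂) ∈ x ∧ (i₂, j₁) ∈ x
  swap
  · exact ⟨x, hfeas, h⟩
  obtain ⟨h₁, h₂⟩ := h
  obtain ⟨hcov, hmem, hcap⟩ := hfeas
  rw [Finset.mem_inter] at hj₁ hj₂
  let x' := insert (i₁, j₁) (insert (i₂, j₂) ((x.erase (i₁, j₂)).erase (i₂, j₁)))
  have hx' (i : F) (j : C) : (i, j) ∈ x' ↔ (i = i₁ ∧ j = j₁) ∨ (i = i₂ ∧ j = j₂) ∨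
      (¬(i = i₂ ∧ j = j₁) ∧ ¬(i = i₁ ∧ j = j₂) ∧ (i, j) ∈ x) := by
    simp only [x', Finset.mem_insert, Finset.mem_erase, Prod.mk.injEq, ne_eq]
  refine ⟨x', ⟨fun j => ?_, fun i j hij => ?_, fun i => ?_⟩, ?_⟩
  · obtain ⟨i, hij⟩ := hcov j
    by_cases e₁ : j = j₁
    · exact ⟨i₁, (hx' _ _).2 (Or.inl ⟨rfl, e₁⟩)⟩
    by_cases e₂ : j = j₂
    · exact ⟨i₂, (hx' _ _).2 (Or.inr (Or.inl ⟨rfl, e₂⟩))⟩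
    exact ⟨i, (hx' _ _).2 (Or.inr (Or.inr ⟨fun h => e₁ h.2, fun h => e₂ h.2, hij⟩))⟩
  · rcases (hx' i j).1 hij with ⟨rfl, rfl⟩ | ⟨rfl, rfl⟩ | ⟨-, -, h⟩
    · exact ⟨hj₁.1, (hmem _ _ h₁).2⟩
    · exact ⟨hj₂.2, (hmem _ _ h₂).2⟩
    · exact hmem _ _ h
  · refine le_trans ?_ (hcap i)
    by_cases e₁ : i = i₁
    · subst e₁
      refine sum_le_of_subset_insert_erase q (a := j₁) (b := j₂) (by simpa using h₁) hq ?_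
      intro j hj
      simp only [Finset.mem_filter, Finset.mem_univ, true_and, Finset.mem_insert,
        Finset.mem_erase, hx'] at hj ⊢
      tauto
    by_cases e₂ : i = i₂
    · subst e₂
      refine sum_le_of_subset_insert_erase q (a := j₂) (b := j₁) (by simpa using h₂) hq.symm ?_
      intro j hj
      simp only [Finset.mem_filter, Finset.mem_univ, true_and, Finset.mem_insert,
        Finset.mem_erase, hx'] at hj ⊢
      tauto
    refine Finset.sum_le_sum_of_subset fun j hj => ?_
    simp only [Finset.mem_filter, Finset.mem_univ, true_and, hx'] at hj ⊢
    tauto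
  · rintro ⟨h, -⟩
    rcases (hx' _ _).1 h with h | h | h
    · exact hj h.2.symm
    · exact hi h.1
    · exact h.2.1 ⟨rfl, rfl⟩
end

section
/- Capacity (rounding) inequalities (Proposition 5). Let (x, Y) be a feasible CSCP-r solution, let S ⊆ C be any subset of customers, let F_S = {i ∈ F : ∃ j ∈ S with j ∈ C_i^r} be the set of facilities covering at least one customer of S, and let γ be a positive integer. Then ∑_{k ∈ F_S ∩ Y} ⌈Q(k)/γ⌉ ≥ ⌈(∑_{j ∈ S} q(j))/γ⌉, where ⌈·⌉ denotes the ceiling of the corresponding rational division. -/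
open Finset

/-- **Capacity (rounding) inequalities (Proposition 5).** -/
theorem capacity_inequality {F C : Type*} [Fintype F] [Fintype C]
    [DecidableEq F] [DecidableEq C]
    (d : F → C → ℝ) (q : C → ℕ) (Q : F → ℕ) (r : ℝ)
    (x : Finset (F × C)) (Y : Finset F)
    (hfeas : CSCPFeasible d q Q r x Y)
    (S : Finset C) (γ : ℕ) (hγ : 0 < γ) :
    ⌈((∑ j ∈ S, q j : ℕ) : ℚ) / (γ : ℚ)⌉ ≤
      ∑ k ∈ (Finset.univ.filter
          (fun i : F => ∃ j ∈ S, j ∈ coverSet d q Q r i)) ∩ Y,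
        ⌈((Q k : ℚ) / (γ : ℚ))⌉ := by
  obtain ⟨hassign, hcover, hcap⟩ := hfeas
  choose f hf using hassign
  set T := (Finset.univ.filter
    (fun i : F => ∃ j ∈ S, j ∈ coverSet d q Q r i)) ∩ Y with hT
  have hmaps : ∀ j ∈ S, f j ∈ T := by
    intro j hj
    have hj' := hcover (f j) j (hf j)
    simp only [hT, Finset.mem_inter, Finset.mem_filter, Finset.mem_univ, true_and]
    exact ⟨⟨j, hj, hj'.1⟩, hj'.2⟩
  have hsum : ∑ j ∈ S, q j ≤ ∑ k ∈ T, Q k := by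
    rw [← Finset.sum_fiberwise_of_maps_to hmaps]
    refine Finset.sum_le_sum fun k _ => le_trans ?_ (hcap k)
    refine Finset.sum_le_sum_of_subset fun j hj => ?_
    obtain ⟨-, rfl⟩ := Finset.mem_filter.1 hj
    exact Finset.mem_filter.2 ⟨Finset.mem_univ _, hf j⟩
  rw [Int.ceil_le]
  calc ((∑ j ∈ S, q j : ℕ) : ℚ) / γ ≤ ((∑ k ∈ T, Q k : ℕ) : ℚ) / γ := by
        gcongr
    _ = ∑ k ∈ T, (Q k : ℚ) / γ := by rw [Nat.cast_sum, Finset.sum_div]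
    _ ≤ ∑ k ∈ T, ((⌈(Q k : ℚ) / γ⌉ : ℤ) : ℚ) := Finset.sum_le_sum fun k _ => Int.le_ceil _
    _ = ((∑ k ∈ T, ⌈(Q k : ℚ) / γ⌉ : ℤ) : ℚ) := by rw [Int.cast_sum]
end

section
/- Subset sum inequalities (Proposition 6). Let i ∈ F, let k ∈ C_i^r, and let β¹ ∈ ℕ be such that for every T ⊆ C_i^r \ {k} with ∑_{j ∈ T} q(j) ≤ Q(i) − q(k) one has ∑_{j ∈ T} q(j) ≤ β¹, and β¹ ≤ Q(i) − q(k). Then every feasible CSCP-r solution (x, Y) satisfies ∑_{j ∈ C_i^r \ {k}, (i,j) ∈ x} q(j) + (Q(i) − β¹)·[(i,k) ∈ x] ≤ Q(i)·[i ∈ Y], where [·] denotes the 0/1 indicator. -/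
open Finset

/-- **Subset sum inequalities (Proposition 6).** -/
theorem subset_sum_inequality {F C : Type*} [Fintype F] [Fintype C]
    [DecidableEq F] [DecidableEq C]
    (d : F → C → ℝ) (q : C → ℕ) (Q : F → ℕ) (r : ℝ)
    (i : F) (k : C) (hk : k ∈ coverSet d q Q r i) (β₁ : ℕ)
    (hβ₁ : ∀ T ⊆ coverSet d q Q r i \ {k},
      ∑ j ∈ T, q j ≤ Q i - q k → ∑ j ∈ T, q j ≤ β₁)
    (hβ₁le : β₁ ≤ Q i - q k)
    (x : Finset (F × C)) (Y : Finset F)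
    (hfeas : CSCPFeasible d q Q r x Y) :
    ∑ j ∈ (coverSet d q Q r i \ {k}).filter (fun j => (i, j) ∈ x), q j +
        (Q i - β₁) * (if (i, k) ∈ x then 1 else 0) ≤
      Q i * (if i ∈ Y then 1 else 0) := by
  obtain ⟨-, hx, hcap⟩ := hfeas
  set S := (coverSet d q Q r i \ {k}).filter (fun j => (i, j) ∈ x) with hS
  by_cases hY : i ∈ Y
  · have hcapi := hcap i
    by_cases hkx : (i, k) ∈ x
    · have hkS : k ∉ S := by simp [hS]
      have hsub : insert k S ⊆ Finset.univ.filter (fun j => (i, j) ∈ x) := by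
        intro j hj
        rcases Finset.mem_insert.mp hj with rfl | hj
        · simpa using hkx
        · simpa using (Finset.mem_filter.mp hj).2
      have hsum : ∑ j ∈ insert k S, q j ≤ Q i :=
        (Finset.sum_le_sum_of_subset hsub).trans hcapi
      rw [Finset.sum_insert hkS] at hsum
      have hle := hβ₁ S (Finset.filter_subset _ _) (by omega)
      simp only [hY, hkx, if_true, mul_one]
      omega
    · have hsub : S ⊆ Finset.univ.filter (fun j => (i, j) ∈ x) :=
        Finset.filter_subset_filter _ (Finset.subset_univ _)
      simpa [hY, hkx] using (Finset.sum_le_sum_of_subset hsub).trans hcapi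
  · have hnot : ∀ j, (i, j) ∉ x := fun j hj => hY (hx i j hj).2
    simp [hS, hnot]
end

section
/- Disjunctive subset sum inequalities (Proposition 7). Let i ∈ F, let k ∈ C_i^r, and let β⁰, β¹ ∈ ℕ with β¹ ≤ β⁰ be such that: for every T ⊆ C_i^r \ {k} with ∑_{j ∈ T} q(j) ≤ Q(i) one has ∑_{j ∈ T} q(j) ≤ β⁰, and for every T ⊆ C_i^r \ {k} with ∑_{j ∈ T} q(j) ≤ Q(i) − q(k) one has ∑_{j ∈ T} q(j) ≤ β¹. Then every feasible CSCP-r solution (x, Y) satisfies, as an inequality of integers, ∑_{j ∈ C_i^r \ {k}, (i,j) ∈ x} q(j) ≤ β⁰·[i ∈ Y] − (β⁰ − β¹)·[(i,k) ∈ x], where [·] denotes the 0/1 indicator. -/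
open Finset

/-- **Disjunctive subset sum inequalities (Proposition 7).** -/
theorem disjunctive_subset_sum_inequality {F C : Type*} [Fintype F] [Fintype C]
    [DecidableEq F] [DecidableEq C]
    (d : F → C → ℝ) (q : C → ℕ) (Q : F → ℕ) (r : ℝ)
    (i : F) (k : C) (hk : k ∈ coverSet d q Q r i) (β₀ β₁ : ℕ) (hββ : β₁ ≤ β₀)
    (hβ₀ : ∀ T ⊆ coverSet d q Q r i \ {k},
      ∑ j ∈ T, q j ≤ Q i → ∑ j ∈ T, q j ≤ β₀)
    (hβ₁ : ∀ T ⊆ coverSet d q Q r i \ {k},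
      ∑ j ∈ T, q j ≤ Q i - q k → ∑ j ∈ T, q j ≤ β₁)
    (x : Finset (F × C)) (Y : Finset F)
    (hfeas : CSCPFeasible d q Q r x Y) :
    ((∑ j ∈ (coverSet d q Q r i \ {k}).filter (fun j => (i, j) ∈ x), q j : ℕ) : ℤ) ≤
      (β₀ : ℤ) * (if i ∈ Y then 1 else 0) -
        ((β₀ : ℤ) - (β₁ : ℤ)) * (if (i, k) ∈ x then 1 else 0) := by
  obtain ⟨-, hx, hcap⟩ := hfeas
  set T := (coverSet d q Q r i \ {k}).filter (fun j => (i, j) ∈ x) with hT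
  have hTsub : T ⊆ coverSet d q Q r i \ {k} := Finset.filter_subset _ _
  have hTx : T ⊆ Finset.univ.filter (fun j => (i, j) ∈ x) := fun j hj =>
    Finset.mem_filter.2 ⟨Finset.mem_univ j, (Finset.mem_filter.1 hj).2⟩
  have hkT : k ∉ T := by simp [hT]
  by_cases hY : i ∈ Y
  · by_cases hik : (i, k) ∈ x
    · have hins : insert k T ⊆ Finset.univ.filter (fun j => (i, j) ∈ x) :=
        Finset.insert_subset (by simpa using hik) hTx
      have hle := (Finset.sum_le_sum_of_subset (f := q) hins).trans (hcap i)
      rw [Finset.sum_insert hkT] at hle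
      have hb := hβ₁ T hTsub (by omega)
      simp only [hY, hik, if_true]
      omega
    · have hb := hβ₀ T hTsub ((Finset.sum_le_sum_of_subset hTx).trans (hcap i))
      simp only [hY, hik, if_true, if_false]
      omega
  · have hnone : ∀ j, (i, j) ∉ x := fun j hj => hY (hx i j hj).2
    simp [hT, hY, hnone]
end

section
/- Layered search recurrence (Proposition 9). Let T : ℕ → ℕ → ℝ satisfy T(1, N) ≤ N for every N ∈ ℕ, and T(L, N) ≤ (N : ℝ)^{1/L} + T(L − 1, ⌈(N : ℝ)^{(L−1)/L}⌉ − 1) for every L ≥ 2 and every N ∈ ℕ (where the second argument ⌈(N : ℝ)^{(L−1)/L}⌉ − 1 is taken as a natural number, using truncated subtraction). Then T(L, N) ≤ L · (N : ℝ)^{1/L} for every L ≥ 1 and every N ∈ ℕ. -/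
/-- The natural number preceding `⌈x⌉` (truncated at zero) is at most `x`, for `0 ≤ x`. -/
theorem natCast_toNat_ceil_sub_one_le {x : ℝ} (hx : 0 ≤ x) :
    ((⌈x⌉.toNat - 1 : ℕ) : ℝ) ≤ x := by
  rw [Int.ceil_toNat]
  rcases Nat.eq_zero_or_pos ⌈x⌉₊ with h | h
  · simpa [h] using hx
  · rw [Nat.cast_pred h]
    linarith [Nat.ceil_lt_add_one hx]

/-- **Layered search recurrence (Proposition 9).** If `T` satisfies the layered-search
recurrence, then `T L N ≤ L · N^(1/L)`. -/
theorem layered_search_recurrence (T : ℕ → ℕ → ℝ)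
    (hbase : ∀ N : ℕ, T 1 N ≤ N)
    (hrec : ∀ L N : ℕ, 2 ≤ L →
      T L N ≤ (N : ℝ) ^ ((1 : ℝ) / L) +
        T (L - 1) ((⌈(N : ℝ) ^ (((L : ℝ) - 1) / L)⌉).toNat - 1)) :
    ∀ L N : ℕ, 1 ≤ L → T L N ≤ (L : ℝ) * (N : ℝ) ^ ((1 : ℝ) / L) := by
  intro L N hL
  induction L, hL using Nat.le_induction generalizing N with
  | base => simpa using hbase N
  | succ L hL ih =>
    have hL0 : (L : ℝ) ≠ 0 := by positivity
    have hstep := hrec (L + 1) N (by omega)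
    rw [Nat.add_sub_cancel, Nat.cast_succ, add_sub_cancel_right] at hstep
    have hle : (((⌈(N : ℝ) ^ ((L : ℝ) / (L + 1))⌉).toNat - 1 : ℕ) : ℝ) ^ ((1 : ℝ) / L) ≤
        (N : ℝ) ^ ((1 : ℝ) / (L + 1)) := by
      calc _ ≤ ((N : ℝ) ^ ((L : ℝ) / (L + 1))) ^ ((1 : ℝ) / L) :=
            Real.rpow_le_rpow (by positivity)
              (natCast_toNat_ceil_sub_one_le (by positivity)) (by positivity)
        _ = (N : ℝ) ^ ((1 : ℝ) / (L + 1)) := by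
            rw [← Real.rpow_mul (by positivity)]
            congr 1
            field_simp
    have hmul := mul_le_mul_of_nonneg_left hle (Nat.cast_nonneg (α := ℝ) L)
    rw [Nat.cast_succ]
    linarith [ih ((⌈(N : ℝ) ^ ((L : ℝ) / (L + 1))⌉).toNat - 1)]
end

section
/- Decomposition equivalence between CPCP feasibility at radius r and CSCP-r feasibility. Let p ∈ ℕ. The following are equivalent: (a) there exist an assignment a : C → F and a set Y ⊆ F with |Y| ≤ p such that a(j) ∈ Y and d(a(j), j) ≤ r for every j ∈ C, and ∑_{j : a(j) = i} q(j) ≤ Q(i) for every i ∈ F; (b) there exists a feasible CSCP-r solution (x, Y') with |Y'| ≤ p. -/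
open Finset

/-- **Decomposition equivalence between CPCP feasibility at radius `r` and CSCP-r
feasibility.** -/
theorem cpcp_cscp_equivalence {F C : Type*} [Fintype F] [Fintype C]
    [DecidableEq F] [DecidableEq C]
    (d : F → C → ℝ) (q : C → ℕ) (Q : F → ℕ) (r : ℝ) (p : ℕ) :
    (∃ (a : C → F) (Y : Finset F), Y.card ≤ p ∧
        (∀ j : C, a j ∈ Y ∧ d (a j) j ≤ r) ∧
        (∀ i : F, ∑ j ∈ Finset.univ.filter (fun j => a j = i), q j ≤ Q i)) ↔
      (∃ (x : Finset (F × C)) (Y' : Finset F),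
        CSCPFeasible d q Q r x Y' ∧ Y'.card ≤ p) := by
  constructor
  · rintro ⟨a, Y, hcard, hY, hcap⟩
    refine ⟨Finset.univ.image (fun j => (a j, j)), Y, ⟨fun j => ⟨a j, by simp⟩, ?_, ?_⟩, hcard⟩
    · intro i j hij
      obtain rfl : a j = i := by simpa using hij
      have hle : q j ≤ ∑ k ∈ Finset.univ.filter (fun k => a k = a j), q k :=
        Finset.single_le_sum (f := q) (fun _ _ => Nat.zero_le _) (by simp)
      exact ⟨by simpa [coverSet] using ⟨(hY j).2, hle.trans (hcap (a j))⟩, (hY j).1⟩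
    · intro i
      simpa using hcap i
  · rintro ⟨x, Y, ⟨hassign, hcover, hcap⟩, hcard⟩
    choose a ha using hassign
    refine ⟨a, Y, hcard, fun j => ?_, fun i => ?_⟩
    · obtain ⟨hj, hi⟩ := hcover (a j) j (ha j)
      exact ⟨hi, (Finset.mem_filter.mp hj).2.1⟩
    · refine (Finset.sum_le_sum_of_subset ?_).trans (hcap i)
      intro j hj
      obtain rfl : a j = i := by simpa using hj
      simpa using ha j
end

section
/- Characterization of the optimal CPCP value via CSCP-r feasibility. Assume C is nonempty and that there exists at least one feasible CPCP solution. Then the minimum over all feasible CPCP solutions (a, Y) of max_{j ∈ C} d(a(j), j) equals the least element r of the finite set {d(i, j) : i ∈ F, j ∈ C} for which there exists a feasible CSCP-r solution (x, Y') with |Y'| ≤ p. -/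
open Finset

/-- Feasibility of a CPCP solution `(a, Y)` with at most `p` open facilities. -/
def CPCPFeasible {F C : Type*} [Fintype C] [DecidableEq F]
    (q : C → ℕ) (Q : F → ℕ) (p : ℕ) (a : C → F) (Y : Finset F) : Prop :=
  Y.card ≤ p ∧ (∀ j : C, a j ∈ Y) ∧
  (∀ i : F, ∑ j ∈ Finset.univ.filter (fun j => a j = i), q j ≤ Q i)

/-- An assignment of radius at most `r` is a CSCP-r solution with the same open facilities. -/
theorem CPCPFeasible.cscpFeasible {F C : Type*} [Fintype C] [DecidableEq F] [DecidableEq C]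
    {d : F → C → ℝ} {q : C → ℕ} {Q : F → ℕ} {p : ℕ} {a : C → F} {Y : Finset F} {r : ℝ}
    (h : CPCPFeasible q Q p a Y) (hr : ∀ j, d (a j) j ≤ r) :
    CSCPFeasible d q Q r (Finset.univ.image fun j => (a j, j)) Y := by
  obtain ⟨-, hY, hQ⟩ := h
  have hmem (i : F) (j : C) : (i, j) ∈ Finset.univ.image (fun j => (a j, j)) ↔ a j = i := by
    simp
  refine ⟨fun j => ⟨a j, (hmem _ _).2 rfl⟩, fun i j hij => ?_, fun i => ?_⟩
  · obtain rfl := (hmem i j).1 hij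
    have hj : q j ≤ Q (a j) :=
      (Finset.single_le_sum (f := q) (fun _ _ => Nat.zero_le _) (by simp)).trans (hQ (a j))
    exact ⟨by simpa [coverSet] using ⟨hr j, hj⟩, hY j⟩
  · simpa only [hmem] using hQ i

/-- Choosing one covering facility per customer turns a CSCP-r solution into an assignment of
radius at most `r`. -/
theorem CSCPFeasible.exists_cpcpFeasible {F C : Type*} [Fintype C] [DecidableEq F]
    [DecidableEq C] {d : F → C → ℝ} {q : C → ℕ} {Q : F → ℕ} {p : ℕ} {r : ℝ}
    {x : Finset (F × C)} {Y : Finset F} (h : CSCPFeasible d q Q r x Y) (hp : Y.card ≤ p) :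
    ∃ a : C → F, CPCPFeasible q Q p a Y ∧ ∀ j, d (a j) j ≤ r := by
  obtain ⟨hcov, hx, hQ⟩ := h
  choose a ha using hcov
  refine ⟨a, ⟨hp, fun j => (hx _ _ (ha j)).2, fun i => le_trans ?_ (hQ i)⟩, fun j => ?_⟩
  · refine Finset.sum_le_sum_of_subset fun j hj => ?_
    obtain rfl := (Finset.mem_filter.1 hj).2
    simpa using ha j
  · exact (Finset.mem_filter.1 (hx _ _ (ha j)).1).2.1

/-- **Characterization of the optimal CPCP value via CSCP-r feasibility.** The optimal
CPCP value is the least entry `r` of the distance matrix such that the CSCP-r problem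
admits a feasible solution opening at most `p` facilities. -/
theorem cpcp_optimum_characterization {F C : Type*} [Fintype F] [Fintype C]
    [DecidableEq F] [DecidableEq C] [Nonempty C]
    (d : F → C → ℝ) (q : C → ℕ) (Q : F → ℕ) (p : ℕ)
    (hfeas : ∃ (a : C → F) (Y : Finset F), CPCPFeasible q Q p a Y) :
    ∃ (a : C → F) (Y : Finset F), CPCPFeasible q Q p a Y ∧
      (∀ (a' : C → F) (Y' : Finset F), CPCPFeasible q Q p a' Y' →
        Finset.univ.sup' Finset.univ_nonempty (fun j : C => d (a j) j) ≤
          Finset.univ.sup' Finset.univ_nonempty (fun j : C => d (a' j) j)) ∧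
      IsLeast {s : ℝ | (∃ (i : F) (j : C), d i j = s) ∧
          ∃ (x : Finset (F × C)) (Y' : Finset F),
            CSCPFeasible d q Q s x Y' ∧ Y'.card ≤ p}
        (Finset.univ.sup' Finset.univ_nonempty (fun j : C => d (a j) j)) := by
  obtain ⟨a₀, Y₀, h₀⟩ := hfeas
  obtain ⟨⟨a, Y⟩, h, hmin⟩ := Set.exists_min_image
    {s : (C → F) × Finset F | CPCPFeasible q Q p s.1 s.2}
    (fun s => Finset.univ.sup' Finset.univ_nonempty (fun j : C => d (s.1 j) j))
    (Set.toFinite _) ⟨(a₀, Y₀), h₀⟩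
  refine ⟨a, Y, h, fun a' Y' h' => hmin (a', Y') h', ⟨?_, _, Y, h.cscpFeasible fun j =>
    Finset.le_sup' (fun j => d (a j) j) (Finset.mem_univ j), h.1⟩, ?_⟩
  · obtain ⟨j, -, hj⟩ := Finset.exists_mem_eq_sup' Finset.univ_nonempty fun j : C => d (a j) j
    exact ⟨a j, j, hj.symm⟩
  · rintro r ⟨-, x, Y', hx, hp⟩
    obtain ⟨a', h', hr⟩ := hx.exists_cpcpFeasible hp
    exact (hmin (a', Y') h').trans (Finset.sup'_le _ _ fun j _ => hr j)
end
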